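/- Let A ⊆ ℕ be a c.e. set which is simple and not hyperhypersimple. Then E_A is a dark ceer (E_A has infinitely many classes and id is not computably reducible to E_A), and E_A⁺ is computably bireducible with =^{ce}. -/

import Mathlib

/-- The `e`-th partial computable function. -/
def phi (e : ℕ) : ℕ →. ℕ :=
  Nat.Partrec.Code.eval (Denumerable.ofNat Nat.Partrec.Code e)

/-- `W_e`, the `e`-th c.e. set: the domain of `φ_e`. -/
def WSet (e : ℕ) : Set ℕ := (phi e).Dom

/-- The `E`-equivalence class of `k`. -/
def classOf (E : ℕ → ℕ → Prop) (k : ℕ) : Set ℕ := {x | E k x}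

/-- Computable reducibility of binary relations on ℕ. -/
def Reduces (E F : ℕ → ℕ → Prop) : Prop :=
  ∃ f : ℕ → ℕ, Computable f ∧ ∀ m n, E m n ↔ F (f m) (f n)

/-- The computable FS-jump of `E`: `e E⁺ e'` iff the set of `E`-classes of elements
of `ran φ_e` equals the set of `E`-classes of elements of `ran φ_{e'}`. -/
def FSJump (E : ℕ → ℕ → Prop) : ℕ → ℕ → Prop :=
  fun e e' => classOf E '' (phi e).ran = classOf E '' (phi e').ran

/-- Equality of c.e. sets: `e =^{ce} e'` iff `W_e = W_{e'}`. -/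
def eqCE : ℕ → ℕ → Prop := fun e e' => WSet e = WSet e'

/-- A set is c.e. if it is `W_e` for some `e`. -/
def CeSet (S : Set ℕ) : Prop := ∃ e : ℕ, S = WSet e

/-- `E_A`: `m E_A n` iff `m = n` or both `m, n ∈ A`. -/
def EA (A : Set ℕ) : ℕ → ℕ → Prop :=
  fun m n => m = n ∨ (m ∈ A ∧ n ∈ A)

/-- A c.e. set is simple if its complement is infinite and contains no infinite
c.e. set. -/
def SimpleSet (A : Set ℕ) : Prop :=
  CeSet A ∧ Aᶜ.Infinite ∧ ∀ W : Set ℕ, CeSet W → W ⊆ Aᶜ → W.Finite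

/-- A c.e. set is hyperhypersimple if for every computable `f` such that the
`W_{f n}` are pairwise disjoint finite sets, some `W_{f n}` is contained in `A`. -/
def HHSimple (A : Set ℕ) : Prop :=
  CeSet A ∧ ∀ f : ℕ → ℕ, Computable f → (∀ n, (WSet (f n)).Finite) →
    (∀ m n, m ≠ n → Disjoint (WSet (f m)) (WSet (f n))) →
    ∃ n, WSet (f n) ⊆ A

theorem re_comp {α β} [Primcodable α] [Primcodable β] {p : β → Prop} (hp : REPred p)
    {f : α → β} (hf : Computable f) : REPred fun a => p (f a) :=
  Partrec.comp hp hf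

theorem re_of_iff_dom {α β} [Primcodable α] [Primcodable β] {p : α → Prop} {f : α →. β}
    (hf : Partrec f) (h : ∀ a, (f a).Dom ↔ p a) : REPred p :=
  (Partrec.dom_re hf).of_eq h

theorem re_and {α} [Primcodable α] {p q : α → Prop} (hp : REPred p) (hq : REPred q) :
    REPred fun a => p a ∧ q a := by
  refine re_of_iff_dom (Partrec.bind hp (Partrec.comp hq Computable.fst).to₂) fun a => ?_
  simp [Part.bind_dom, Part.assert]

theorem re_or {α} [Primcodable α] {p q : α → Prop} (hp : REPred p) (hq : REPred q) :
    REPred fun a => p a ∨ q a := by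
  obtain ⟨k, hk, h⟩ := Partrec.merge' hp hq
  refine re_of_iff_dom hk fun a => ?_
  rw [(h a).2]
  simp [Part.assert]

theorem re_exists {α} [Primcodable α] {p : α × ℕ → Prop} (hp : REPred p) :
    REPred fun a => ∃ n, p (a, n) := by
  obtain ⟨c, hc⟩ := Nat.Partrec.Code.exists_code.1 hp
  have key : ∀ a n, p (a, n) ↔ ∃ s x, x ∈ c.evaln s (Encodable.encode (a, n)) := by
    intro a n
    rw [exists_comm]
    simp only [← Nat.Partrec.Code.evaln_complete]
    rw [← Part.dom_iff_mem, hc]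
    simp only [Encodable.encodek, Part.coe_some, Part.bind_some, Part.map_Dom]
    simp [Part.assert]
  have hf : Partrec fun a : α => Nat.rfindOpt fun s =>
      c.evaln s.unpair.1 (Encodable.encode (a, s.unpair.2)) := by
    have hu : Computable fun q : α × ℕ => q.2.unpair := Computable.unpair.comp Computable.snd
    have hu1 : Computable fun q : α × ℕ => q.2.unpair.1 := Computable.fst.comp hu
    have hu2 : Computable fun q : α × ℕ => q.2.unpair.2 := Computable.snd.comp hu
    have hp : Computable fun q : α × ℕ => (q.1, q.2.unpair.2) := Computable.fst.pair hu2
    have he : Computable fun q : α × ℕ => Encodable.encode (q.1, q.2.unpair.2) :=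
      Computable.encode.comp hp
    have hin : Computable fun q : α × ℕ =>
        ((q.2.unpair.1, c), Encodable.encode (q.1, q.2.unpair.2)) :=
      (hu1.pair (Computable.const c)).pair he
    have hev : Computable fun q : α × ℕ =>
        Nat.Partrec.Code.evaln q.2.unpair.1 c (Encodable.encode (q.1, q.2.unpair.2)) :=
      Computable.comp (f := fun a : (ℕ × Nat.Partrec.Code) × ℕ =>
        Nat.Partrec.Code.evaln a.1.1 a.1.2 a.2) Nat.Partrec.Code.primrec_evaln.to_comp hin
    exact Partrec.rfindOpt (f := fun (a : α) (s : ℕ) =>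
      Nat.Partrec.Code.evaln s.unpair.1 c (Encodable.encode (a, s.unpair.2))) hev
  refine re_of_iff_dom hf fun a => ?_
  rw [Nat.rfindOpt_dom]
  constructor
  · rintro ⟨s, x, h⟩
    exact ⟨s.unpair.2, (key _ _).2 ⟨_, _, h⟩⟩
  · rintro ⟨n, h⟩
    obtain ⟨s, x, h⟩ := (key _ _).1 h
    exact ⟨Nat.pair s n, x, by simpa using h⟩

theorem re_eq {α} [Primcodable α] {f g : α → ℕ} (hf : Computable f) (hg : Computable g) :
    REPred fun a => f a = g a := by
  have h : PrimrecRel (fun a b : ℕ => a = b) := Primrec.eq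
  have h2 : REPred fun p : ℕ × ℕ => p.1 = p.2 := by
    apply ComputablePred.to_re
    exact PrimrecPred.computablePred h
  exact re_comp h2 (hf.pair hg)

theorem phi_partrec : Partrec₂ phi :=
  Nat.Partrec.Code.eval_part.comp₂ ((Computable.ofNat _).comp Computable.fst).to₂
    Computable.snd.to₂

/-- Membership in `W_e` is c.e. uniformly. -/
theorem re_mem_W {α} [Primcodable α] {f g : α → ℕ} (hf : Computable f) (hg : Computable g) :
    REPred fun a => g a ∈ WSet (f a) :=
  Partrec.dom_re (phi_partrec.comp hf hg)

/-- Membership in `ran φ_e` is c.e. uniformly. -/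
theorem re_mem_ran {α} [Primcodable α] {f g : α → ℕ} (hf : Computable f) (hg : Computable g) :
    REPred fun a => g a ∈ (phi (f a)).ran := by
  have h : REPred fun q : α × ℕ => g q.1 ∈ phi (f q.1) q.2 := by
    have he : REPred fun r : (α × ℕ) × ℕ => r.2 = g r.1.1 :=
      re_eq Computable.snd (hg.comp (Computable.fst.comp Computable.fst))
    refine re_of_iff_dom (Partrec.bind
      (phi_partrec.comp (hf.comp Computable.fst) Computable.snd) (Partrec.to₂ he)) fun q => ?_
    simp only [Part.dom_iff_mem, Part.mem_bind_iff]
    constructor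
    · rintro ⟨_, y, hy, h⟩
      simp only [Part.mem_assert_iff] at h
      obtain ⟨h, -⟩ := h
      exact h ▸ hy
    · intro h
      exact ⟨(), _, h, by simp⟩
  exact re_exists h

/-- Uniform c.e. families have a computable index function, with domain equal to range. -/
theorem exists_index {P : ℕ → ℕ → Prop} (hP : REPred fun q : ℕ × ℕ => P q.1 q.2) :
    ∃ g : ℕ → ℕ, Computable g ∧ ∀ e, WSet (g e) = {x | P e x} ∧ (phi (g e)).ran = {x | P e x} := by
  have h1 : Partrec fun n : ℕ =>
      (Part.assert (P n.unpair.1 n.unpair.2) fun _ => Part.some ()).map fun _ => n.unpair.2 :=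
    Partrec.map (Partrec.comp hP Computable.unpair)
      (Computable.snd.comp (Computable.unpair.comp Computable.fst)).to₂
  obtain ⟨c, hc⟩ := Nat.Partrec.Code.exists_code.1 (Partrec.nat_iff.1 h1)
  have hphi : ∀ e x, phi (Encodable.encode (c.curry e)) x =
      (Part.assert (P e x) fun _ => Part.some ()).map fun _ => x := by
    intro e x
    simp only [phi, Denumerable.ofNat_encode, Nat.Partrec.Code.eval_curry, hc]
    rw [Nat.unpair_pair]
  refine ⟨fun e => Encodable.encode (c.curry e), Computable.encode.comp
    (Nat.Partrec.Code.primrec₂_curry.to_comp.comp (Computable.const c) Computable.id),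
    fun e => ⟨?_, ?_⟩⟩
  · ext x
    simp only [WSet, PFun.mem_dom, hphi]
    simp
  · ext x
    simp only [PFun.ran, Set.mem_ofPred_eq, hphi]
    simp

theorem ce_re {A : Set ℕ} (hA : CeSet A) {α} [Primcodable α] {g : α → ℕ} (hg : Computable g) :
    REPred fun a => g a ∈ A := by
  obtain ⟨e, rfl⟩ := hA
  exact re_mem_W (Computable.const e) hg

theorem ce_of_re {S : Set ℕ} (hS : REPred fun x => x ∈ S) : CeSet S := by
  obtain ⟨g, -, h⟩ := exists_index (P := fun _ x => x ∈ S) (re_comp hS Computable.snd)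
  exact ⟨g 0, (h 0).1.symm⟩

theorem EA_equiv (A : Set ℕ) : Equivalence (EA A) := by
  refine ⟨fun _ => Or.inl rfl, fun {x y} h => ?_, fun {x y z} h h' => ?_⟩
  · unfold EA at *; grind
  · unfold EA at *; grind

theorem classOf_eq {A : Set ℕ} {x y : ℕ} : classOf (EA A) x = classOf (EA A) y ↔ EA A x y := by
  constructor
  · intro h
    have : y ∈ classOf (EA A) y := (EA_equiv A).refl y
    rw [← h] at this
    exact this
  · intro h
    ext z
    exact ⟨fun hz => (EA_equiv A).trans ((EA_equiv A).symm h) hz,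
      fun hz => (EA_equiv A).trans h hz⟩

/-- Equality of sets of classes is equality of saturations. -/
theorem image_classOf_eq {A S T : Set ℕ} : classOf (EA A) '' S = classOf (EA A) '' T ↔
    {x | ∃ k, k ∈ S ∧ EA A k x} = {x | ∃ k, k ∈ T ∧ EA A k x} := by
  have key : ∀ (S : Set ℕ) x, classOf (EA A) x ∈ classOf (EA A) '' S ↔ ∃ k, k ∈ S ∧ EA A k x := by
    intro S x
    simp [Set.mem_image, classOf_eq]
  constructor
  · intro h
    ext x
    simp only [Set.mem_ofPred_eq]
    rw [← key, ← key, h]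
  · intro h
    have h' : ∀ x, classOf (EA A) x ∈ classOf (EA A) '' S ↔
        classOf (EA A) x ∈ classOf (EA A) '' T := fun x => by
      rw [key, key]
      exact Set.ext_iff.1 h x
    ext c
    constructor
    · rintro ⟨x, hx, rfl⟩
      exact (h' x).1 ⟨x, hx, rfl⟩
    · rintro ⟨x, hx, rfl⟩
      exact (h' x).2 ⟨x, hx, rfl⟩

theorem sat_of_subset {A S : Set ℕ} (h : A ⊆ S) : {x | ∃ k, k ∈ S ∧ EA A k x} = S := by
  ext x
  constructor
  · rintro ⟨k, hk, rfl | ⟨-, hx⟩⟩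
    · exact hk
    · exact h hx
  · intro hx
    exact ⟨x, hx, Or.inl rfl⟩

/-- If `A` is simple but not hyperhypersimple, then `E_A` is a dark ceer
(infinitely many classes, `id` not reducible to `E_A`) and `E_A` is high for the
computable FS-jump: `(E_A)⁺` is computably bireducible with `=^{ce}`. -/
theorem simple_not_hhsimple_high (A : Set ℕ) (hA : CeSet A)
    (hsimple : SimpleSet A) (hnothh : ¬ HHSimple A) :
    ((Set.range (classOf (EA A))).Infinite ∧ ¬ Reduces (@Eq ℕ) (EA A)) ∧
      (Reduces (FSJump (EA A)) eqCE ∧ Reduces eqCE (FSJump (EA A))) := by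
  refine ⟨⟨?_, ?_⟩, ?_, ?_⟩
  · have hinj : Set.InjOn (classOf (EA A)) Aᶜ := by
      intro x hx y hy h
      rcases classOf_eq.1 h with h | h
      · exact h
      · exact absurd h.1 hx
    exact (hsimple.2.1.image hinj).mono (Set.image_subset_range _ _)
  · rintro ⟨f, hf, h⟩
    have hinj : Function.Injective f := fun m n hmn => (h m n).2 (Or.inl hmn)
    -- past some point the values of `f` avoid `A`
    have hN : ∃ N, ∀ n, N < n → f n ∉ A := by
      by_cases hex : ∃ m, f m ∈ A
      · obtain ⟨m, hm⟩ := hex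
        refine ⟨m, fun n hn hfn => ?_⟩
        have := (h m n).2 (Or.inr ⟨hm, hfn⟩)
        omega
      · push Not at hex
        exact ⟨0, fun n _ => hex n⟩
    obtain ⟨N, hN⟩ := hN
    have hg : Computable fun n => f (n + (N + 1)) :=
      hf.comp (Primrec.nat_add.to_comp.comp Computable.id (Computable.const (N + 1)))
    have hce : CeSet (Set.range fun n => f (n + (N + 1))) := by
      apply ce_of_re
      exact re_exists (p := fun q : ℕ × ℕ => f (q.2 + (N + 1)) = q.1)
        (re_eq (hg.comp Computable.snd) Computable.fst)
    have hfin := hsimple.2.2 _ hce (by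
      rintro _ ⟨n, rfl⟩
      exact hN _ (by omega))
    refine Set.infinite_range_of_injective ?_ hfin
    intro m n hmn
    have := hinj hmn
    omega
  · have hre : REPred fun q : ℕ × ℕ => ∃ k, k ∈ (phi q.1).ran ∧ EA A k q.2 := by
      refine re_exists (p := fun r : (ℕ × ℕ) × ℕ => r.2 ∈ (phi r.1.1).ran ∧ EA A r.2 r.1.2) ?_
      have h2 : Computable fun r : (ℕ × ℕ) × ℕ => r.1.2 := Computable.snd.comp Computable.fst
      exact re_and (re_mem_ran (Computable.fst.comp Computable.fst) Computable.snd)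
        (re_or (re_eq Computable.snd h2) (re_and (ce_re hA Computable.snd) (ce_re hA h2)))
    obtain ⟨g, hg, h⟩ := exists_index
      (P := fun e x => ∃ k, k ∈ (phi e).ran ∧ EA A k x) hre
    refine ⟨g, hg, fun m n => ?_⟩
    unfold FSJump eqCE
    rw [image_classOf_eq, (h m).1, (h n).1]
  · have hex : ∃ f : ℕ → ℕ, Computable f ∧
        (∀ m n, m ≠ n → Disjoint (WSet (f m)) (WSet (f n))) ∧ ∀ n, ¬ WSet (f n) ⊆ A := by
      by_contra hcon
      refine hnothh ⟨hA, fun f hf _ hd => ?_⟩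
      by_contra hn
      push Not at hn
      exact hcon ⟨f, hf, hd, hn⟩
    obtain ⟨f, hf, hd, hn⟩ := hex
    have hre : REPred fun q : ℕ × ℕ => q.2 ∈ A ∨ ∃ n, n ∈ WSet q.1 ∧ q.2 ∈ WSet (f n) := by
      refine re_or (ce_re hA Computable.snd) (re_exists
        (p := fun r : (ℕ × ℕ) × ℕ => r.2 ∈ WSet r.1.1 ∧ r.1.2 ∈ WSet (f r.2)) ?_)
      exact re_and (re_mem_W (Computable.fst.comp Computable.fst) Computable.snd)
        (re_mem_W (hf.comp Computable.snd) (Computable.snd.comp Computable.fst))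
    obtain ⟨g, hg, h⟩ := exists_index
      (P := fun e x => x ∈ A ∨ ∃ n, n ∈ WSet e ∧ x ∈ WSet (f n)) hre
    refine ⟨g, hg, fun e e' => ?_⟩
    unfold FSJump eqCE
    have hsub : ∀ d : ℕ, A ⊆ {x | x ∈ A ∨ ∃ n, n ∈ WSet d ∧ x ∈ WSet (f n)} :=
      fun d x hx => Or.inl hx
    rw [image_classOf_eq, (h e).2, (h e').2, sat_of_subset (hsub e), sat_of_subset (hsub e')]
    constructor
    · intro hW
      rw [hW]
    · intro hB
      have aux : ∀ d d' : ℕ, ({x | x ∈ A ∨ ∃ n, n ∈ WSet d ∧ x ∈ WSet (f n)} : Set ℕ) =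
          {x | x ∈ A ∨ ∃ n, n ∈ WSet d' ∧ x ∈ WSet (f n)} → WSet d ⊆ WSet d' := by
        intro d d' hdd n hnd
        obtain ⟨x, hx, hxA⟩ := Set.not_subset.1 (hn n)
        have hx' : x ∈ A ∨ ∃ n, n ∈ WSet d' ∧ x ∈ WSet (f n) :=
          (Set.ext_iff.1 hdd x).1 (Or.inr ⟨n, hnd, hx⟩)
        rcases hx' with hx' | ⟨m, hm, hxm⟩
        · exact absurd hx' hxA
        · by_cases hmn : m = n
          · exact hmn ▸ hm
          · exact absurd hx (Set.disjoint_left.1 (hd m n hmn) hxm)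
      exact Set.Subset.antisymm (aux _ _ hB) (aux _ _ hB.symm)
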